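/- The synchronous PageRank iteration converges geometrically to the fixed point: if p* is a fixed point of T and pr_i = T^i(pr_0) denotes the i-th iterate started from any pr_0 : V → ℝ, then for every i, Σ_{u ∈ V} |pr_i(u) − p*(u)| ≤ d^i · Σ_{u ∈ V} |pr_0(u) − p*(u)|. -/

import Mathlib

open Finset

/-- Distributing each weight evenly along its outgoing edges does not increase the `ℓ¹` norm. -/
theorem sum_abs_sum_div_outdeg_le {V : Type*} [Fintype V] (E : V → V → Prop) [DecidableRel E]
    (x : V → ℝ) :
    ∑ u, |∑ v with E v u, x v / (#{w | E v w} : ℝ)| ≤ ∑ v, |x v| := by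
  calc ∑ u, |∑ v with E v u, x v / (#{w | E v w} : ℝ)|
      ≤ ∑ u, ∑ v with E v u, |x v / (#{w | E v w} : ℝ)| :=
        sum_le_sum fun u _ => abs_sum_le_sum_abs _ _
    _ = ∑ v, ∑ u with E v u, |x v / (#{w | E v w} : ℝ)| :=
        sum_comm' (by simp)
    _ ≤ ∑ v, |x v| := by
        refine sum_le_sum fun v _ => ?_
        rw [sum_const, nsmul_eq_mul, abs_div, Nat.abs_cast]
        rcases eq_or_ne (#{w | E v w} : ℝ) 0 with h | h
        · simp [h]
        · rw [mul_div_cancel₀ _ h]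

theorem pagerank_geometric_convergence {V : Type*} [Fintype V] [Nonempty V]
    (E : V → V → Prop) [DecidableRel E]
    (hE : ∀ v, ∃ u, E v u)
    (outdeg : V → ℕ)
    (houtdeg : ∀ v, outdeg v = (Finset.univ.filter (fun u => E v u)).card)
    (d : ℝ) (hd0 : 0 ≤ d) (hd1 : d < 1)
    (T : (V → ℝ) → V → ℝ)
    (hT : ∀ p u, T p u = (1 - d) / (Fintype.card V : ℝ) +
        d * ∑ v ∈ Finset.univ.filter (fun v => E v u), p v / (outdeg v : ℝ))
    (pstar : V → ℝ) (hfix : T pstar = pstar)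
    (pr0 : V → ℝ) :
    ∀ i : ℕ, ∑ u, |T^[i] pr0 u - pstar u| ≤ d ^ i * ∑ u, |pr0 u - pstar u| := by
  have contraction (p q : V → ℝ) : ∑ u, |T p u - T q u| ≤ d * ∑ u, |p u - q u| := by
    have hsub (u : V) : T p u - T q u =
        d * ∑ v with E v u, (p v - q v) / (#{w | E v w} : ℝ) := by
      simp only [hT, houtdeg, sub_div, sum_sub_distrib]
      ring
    simp only [hsub, abs_mul, abs_of_nonneg hd0, ← mul_sum]
    exact mul_le_mul_of_nonneg_left (sum_abs_sum_div_outdeg_le E fun v => p v - q v) hd0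
  intro i
  induction i with
  | zero => simp
  | succ i ih =>
    calc ∑ u, |T^[i + 1] pr0 u - pstar u|
        = ∑ u, |T (T^[i] pr0) u - T pstar u| := by
          rw [Function.iterate_succ_apply', hfix]
      _ ≤ d * ∑ u, |T^[i] pr0 u - pstar u| := contraction _ _
      _ ≤ d * (d ^ i * ∑ u, |pr0 u - pstar u|) := mul_le_mul_of_nonneg_left ih hd0
      _ = d ^ (i + 1) * ∑ u, |pr0 u - pstar u| := by ring
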